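/- Let E and F be real separable Banach spaces and let ψ : E → F be a linear map whose graph {(x, ψ(x)) : x ∈ E} is a Borel subset of E × F. Then ψ is continuous (Schwartz's Borel graph theorem for Banach spaces). -/

import Mathlib

open Set Filter Topology Pointwise in
/-- **Pettis' theorem**: the difference set of a nonmeagre Borel set in a Baire topological group is
a neighbourhood of zero. -/
theorem MeasurableSet.sub_self_mem_nhds_zero {G : Type*} [AddGroup G] [TopologicalSpace G]
    [ContinuousAdd G] [BaireSpace G] [MeasurableSpace G] [BorelSpace G] {s : Set G}
    (hs : MeasurableSet s) (hs' : ¬ IsMeagre s) : s - s ∈ 𝓝 (0 : G) := by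
  obtain ⟨U, hU, hsU⟩ := hs.residualEq_isOpen
  obtain ⟨u, hu⟩ : U.Nonempty := by
    rw [nonempty_iff_ne_empty]
    rintro rfl
    exact hs' (eventuallyEq_empty.1 hsU)
  have hnhds : ∀ᶠ x in 𝓝 (0 : G), x + u ∈ U :=
    (continuous_add_const u).continuousAt.eventually_mem (hU.mem_nhds (by simpa using hu))
  filter_upwards [hnhds] with x hx
  have hxs : ∀ᶠ y in residual G, x + y ∈ s ↔ x + y ∈ U :=
    (tendsto_residual_of_isOpenMap (Homeomorph.addLeft x).continuous
      (Homeomorph.addLeft x).isOpenMap).eventually (eventuallyEq_set.1 hsU)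
  obtain ⟨y, ⟨hyU, hxyU⟩, hys, hxys⟩ :=
    (dense_of_mem_residual ((eventuallyEq_set.1 hsU).and hxs)).inter_open_nonempty
      (U ∩ (x + ·) ⁻¹' U) (hU.inter (hU.preimage (continuous_const_add x))) ⟨u, hu, hx⟩
  exact ⟨x + y, hxys.2 hxyU, y, hys.2 hyU, add_sub_cancel_right x y⟩

/-- A function between standard Borel spaces whose graph is measurable is measurable. -/
theorem measurable_of_measurableSet_graph {α β : Type*} [MeasurableSpace α] [StandardBorelSpace α]
    [MeasurableSpace β] [StandardBorelSpace β] {f : α → β}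
    (hf : MeasurableSet {p : α × β | p.2 = f p.1}) : Measurable f := by
  intro t ht
  have hpre : f ⁻¹' t = Prod.fst '' ({p : α × β | p.2 = f p.1} ∩ Prod.snd ⁻¹' t) := by
    ext x
    simp
  rw [hpre]
  refine (hf.inter (measurable_snd ht)).image_of_measurable_injOn measurable_fst ?_
  rintro ⟨x, y⟩ ⟨hy, -⟩ ⟨x', y'⟩ ⟨hy', -⟩ rfl
  exact Prod.ext rfl (hy.trans hy'.symm)

/-- A Borel measurable linear map from a Banach space to a normed space is continuous. -/
theorem LinearMap.continuous_of_measurable {E F : Type*}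
    [NormedAddCommGroup E] [NormedSpace ℝ E] [CompleteSpace E]
    [NormedAddCommGroup F] [NormedSpace ℝ F]
    [MeasurableSpace E] [BorelSpace E] [MeasurableSpace F] [OpensMeasurableSpace F]
    (f : E →ₗ[ℝ] F) (hf : Measurable f) : Continuous f := by
  obtain ⟨n, hn⟩ : ∃ n : ℕ, ¬ IsMeagre (f ⁻¹' Metric.ball 0 n) := by
    by_contra! h
    refine not_isMeagre_of_isOpen (X := E) isOpen_univ Set.univ_nonempty ?_
    rw [← Set.preimage_univ (f := f), ← Metric.iUnion_ball_nat (0 : F), Set.preimage_iUnion]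
    exact isMeagre_iUnion h
  obtain ⟨r, hr, hball⟩ := Metric.mem_nhds_iff.1
    ((hf Metric.isOpen_ball.measurableSet).sub_self_mem_nhds_zero hn)
  obtain ⟨C, hC⟩ := f.bound_of_ball_bound hr (n + n : ℝ) fun z hz ↦ by
    obtain ⟨a, ha, b, hb, rfl⟩ := hball hz
    rw [Set.mem_preimage, mem_ball_zero_iff] at ha hb
    rw [map_sub]
    exact (norm_sub_le _ _).trans (add_le_add ha.le hb.le)
  exact (f.mkContinuous C hC).continuous

/-- Schwartz's Borel graph theorem in the context of Banach spaces. -/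
theorem borel_graph_theorem
    {E F : Type*}
    [NormedAddCommGroup E] [NormedSpace ℝ E] [CompleteSpace E]
    [TopologicalSpace.SeparableSpace E]
    [NormedAddCommGroup F] [NormedSpace ℝ F] [CompleteSpace F]
    [TopologicalSpace.SeparableSpace F]
    [MeasurableSpace E] [BorelSpace E] [MeasurableSpace F] [BorelSpace F]
    (ψ : E →ₗ[ℝ] F)
    (hgraph : MeasurableSet {p : E × F | p.2 = ψ p.1}) :
    Continuous ψ := by
  have := UniformSpace.secondCountable_of_separable E
  have := UniformSpace.secondCountable_of_separable F
  exact ψ.continuous_of_measurable (measurable_of_measurableSet_graph hgraph)
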